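/- arXiv:1910.06911 — 7 statements merged into one kernel-verified Lean document; each statement's English description precedes it below -/
import Mathlib

section
/- Let K ≥ 1 and let A, B, C, D ∈ M_K(ℝ) be matrices with ±1 entries which are circulant (each has (i,j) entry depending only on j−i mod K), symmetric, pairwise commuting, and satisfy A² + B² + C² + D² = 4K·1_K. Then the 4K×4K block matrix H = [[A,B,C,D],[−B,A,−D,C],[−C,D,A,−B],[−D,−C,B,A]] is a real Hadamard matrix of size 4K. -/
/-- The Williamson construction: if `A, B, C, D` are `K × K` sign matrices which are circulant,
symmetric, pairwise commuting and satisfy `A² + B² + C² + D² = 4K·1`, then the `4K × 4K` block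
matrix `[[A,B,C,D],[-B,A,-D,C],[-C,D,A,-B],[-D,-C,B,A]]` is a real Hadamard matrix. -/
theorem stmt_1 (K : ℕ) [NeZero K]
    (A B C D : Matrix (ZMod K) (ZMod K) ℝ)
    (hApm : ∀ i j, A i j = 1 ∨ A i j = -1)
    (hBpm : ∀ i j, B i j = 1 ∨ B i j = -1)
    (hCpm : ∀ i j, C i j = 1 ∨ C i j = -1)
    (hDpm : ∀ i j, D i j = 1 ∨ D i j = -1)
    (hAcirc : ∀ i j k : ZMod K, A (i + k) (j + k) = A i j)
    (hBcirc : ∀ i j k : ZMod K, B (i + k) (j + k) = B i j)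
    (hCcirc : ∀ i j k : ZMod K, C (i + k) (j + k) = C i j)
    (hDcirc : ∀ i j k : ZMod K, D (i + k) (j + k) = D i j)
    (hAs : A.IsSymm) (hBs : B.IsSymm) (hCs : C.IsSymm) (hDs : D.IsSymm)
    (hAB : Commute A B) (hAC : Commute A C) (hAD : Commute A D)
    (hBC : Commute B C) (hBD : Commute B D) (hCD : Commute C D)
    (hsum : A ^ 2 + B ^ 2 + C ^ 2 + D ^ 2 = ((4 * K : ℕ) : ℝ) • 1)
    (H : Matrix (Fin 4 × ZMod K) (Fin 4 × ZMod K) ℝ)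
    (hH : ∀ p q : Fin 4 × ZMod K,
      H p q = ![![A, B, C, D], ![-B, A, -D, C], ![-C, D, A, -B], ![-D, -C, B, A]]
        p.1 q.1 p.2 q.2) :
    (∀ p q, H p q = 1 ∨ H p q = -1) ∧
      H * H.transpose = ((4 * K : ℕ) : ℝ) • (1 : Matrix (Fin 4 × ZMod K) (Fin 4 × ZMod K) ℝ) := by
  constructor
  · have neg : ∀ x : ℝ, (x = 1 ∨ x = -1) → (-x = 1 ∨ -x = -1) := by
      rintro x (h | h) <;> simp [h]
    rintro ⟨a, i⟩ ⟨b, j⟩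
    rw [hH]
    fin_cases a <;> fin_cases b <;>
      first
        | exact hApm i j
        | exact hBpm i j
        | exact hCpm i j
        | exact hDpm i j
        | exact neg _ (hBpm i j)
        | exact neg _ (hCpm i j)
        | exact neg _ (hDpm i j)
  · obtain ⟨M, hM⟩ : ∃ M : Fin 4 → Fin 4 → Matrix (ZMod K) (ZMod K) ℝ,
        M = ![![A, B, C, D], ![-B, A, -D, C], ![-C, D, A, -B], ![-D, -C, B, A]] := ⟨_, rfl⟩
    have key : ∀ a b, ∑ c, M a c * (M b c).transpose =
        if a = b then ((4 * K : ℕ) : ℝ) • (1 : Matrix (ZMod K) (ZMod K) ℝ) else 0 := by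
      intro a b
      have e1 := hAB.eq
      have e2 := hAC.eq
      have e3 := hAD.eq
      have e4 := hBC.eq
      have e5 := hBD.eq
      have e6 := hCD.eq
      rw [← hsum, hM]
      fin_cases a <;> fin_cases b <;>
        simp [Fin.sum_univ_four, hAs.eq, hBs.eq, hCs.eq, hDs.eq, e1, e2, e3, e4, e5, e6, pow_two] <;>
        abel
    ext ⟨a, i⟩ ⟨b, j⟩
    have h := congrFun (congrFun (key a b) i) j
    rw [Matrix.sum_apply] at h
    rw [Matrix.mul_apply, Fintype.sum_prod_type]
    simp only [Matrix.transpose_apply, hH, ← hM]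
    simp only [Matrix.mul_apply, Matrix.transpose_apply] at h
    rw [h]
    by_cases hab : a = b
    · subst hab
      simp [Matrix.one_apply]
    · simp [hab, Matrix.one_apply]
end

section
/- Let N be an even positive integer and suppose that there exists no real Hadamard matrix of size N. Then every real orthogonal matrix U ∈ O_N satisfies ∑_{i,j} |U_{ij}| ≤ N√N − 1/(N√N). -/
/-- If `N` is even and there is no real Hadamard matrix of size `N`, then every real
orthogonal `N × N` matrix `U` satisfies `∑_{ij} |U_ij| ≤ N√N - 1/(N√N)`. -/
theorem stmt_4 (N : ℕ) (hNpos : 0 < N) (hNeven : Even N)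
    (hno : ¬ ∃ H : Matrix (Fin N) (Fin N) ℝ,
      (∀ i j, H i j = 1 ∨ H i j = -1) ∧
        H * H.transpose = (N : ℝ) • (1 : Matrix (Fin N) (Fin N) ℝ))
    (U : Matrix (Fin N) (Fin N) ℝ) (hU : U * U.transpose = 1) :
    ∑ i, ∑ j, |U i j| ≤ N * Real.sqrt N - 1 / (N * Real.sqrt N) := by
  obtain ⟨T, hT⟩ : ∃ T : Fin N → Fin N → ℤ, ∀ i j, (T i j = 1 ∨ T i j = -1) ∧
      |U i j| = T i j * U i j := by
    refine ⟨fun i j => if 0 ≤ U i j then 1 else -1, fun i j => ?_⟩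
    by_cases h : 0 ≤ U i j
    · simp [h, abs_of_nonneg h]
    · simp [h, abs_of_neg (not_le.mp h)]
  have hTsq : ∀ i j, (T i j : ℝ) ^ 2 = 1 := by
    intro i j
    rcases (hT i j).1 with h | h <;> simp [h]
  -- two distinct rows whose scalar product is nonzero
  obtain ⟨i, k, hik, hg⟩ : ∃ i k, i ≠ k ∧ ∑ j, T i j * T k j ≠ 0 := by
    by_contra! hcon
    apply hno
    refine ⟨Matrix.of fun i j => (T i j : ℝ), fun i j => ?_, ?_⟩
    · rcases (hT i j).1 with h | h <;> simp [h]
    · ext i k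
      rw [Matrix.mul_apply]
      by_cases h : i = k
      · subst h
        simp [← pow_two, hTsq]
      · have := hcon i k h
        simp only [Matrix.transpose_apply, Matrix.of_apply, Matrix.smul_apply, Matrix.one_apply_ne h, smul_zero]
        exact_mod_cast this
  have heven : (2 : ℤ) ∣ ∑ j, T i j * T k j := by
    have h1 : (2 : ℤ) ∣ ∑ j, (T i j * T k j + 1) := by
      apply Finset.dvd_sum
      intro j _
      rcases (hT i j).1 with h | h <;> rcases (hT k j).1 with h' | h' <;> simp [h, h']
    rw [Finset.sum_add_distrib] at h1
    simp only [Finset.sum_const, Finset.card_univ, Fintype.card_fin, nsmul_eq_mul, mul_one] at h1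
    obtain ⟨m, hm⟩ := hNeven
    omega
  have hg4 : (4 : ℝ) ≤ (∑ j, (T i j : ℝ) * T k j) ^ 2 := by
    obtain ⟨m, hm⟩ := heven
    have hm0 : m ≠ 0 := by
      rintro rfl
      simp at hm
      exact hg hm
    have h1 : 1 ≤ m ^ 2 := by
      have : 0 < m ^ 2 := by positivity
      omega
    have h2 : (4 : ℤ) ≤ (∑ j, T i j * T k j) ^ 2 := by rw [hm]; nlinarith
    exact_mod_cast h2
  have hn : (0 : ℝ) < N := by exact_mod_cast hNpos
  set r := Real.sqrt N with hr
  have hr0 : 0 < r := Real.sqrt_pos.mpr hn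
  have hrr : r ^ 2 = N := Real.sq_sqrt hn.le
  have hUd : ∀ a, ∑ j, U a j ^ 2 = 1 := by
    intro a
    have := congrFun (congrFun hU a) a
    simpa [Matrix.mul_apply, pow_two] using this
  have hUo : ∑ j, U i j * U k j = 0 := by
    have := congrFun (congrFun hU i) k
    simpa [Matrix.mul_apply, Matrix.one_apply_ne hik] using this
  set e : Fin N → ℝ := fun a => ∑ j, ((T a j : ℝ) - r * U a j) ^ 2 with he
  have hee : ∀ a, e a = 2 * N - 2 * r * ∑ j, |U a j| := by
    intro a
    have h1 : ∀ j, ((T a j : ℝ) - r * U a j) ^ 2 = 1 - 2 * r * |U a j| + r ^ 2 * U a j ^ 2 := by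
      intro j
      rw [(hT a j).2, ← hTsq a j]; ring
    simp only [he, h1, Finset.sum_add_distrib, Finset.sum_sub_distrib, ← Finset.mul_sum, hUd, hrr]
    simp
    ring
  have hsum : ∑ a, e a = 2 * N * N - 2 * r * ∑ a, ∑ j, |U a j| := by
    simp only [hee, Finset.sum_sub_distrib, ← Finset.mul_sum]
    simp
    ring
  have hle : e i + e k ≤ ∑ a, e a := by
    rw [← Finset.sum_pair hik]
    apply Finset.sum_le_sum_of_subset_of_nonneg (Finset.subset_univ _)
    intro a _ _
    exact Finset.sum_nonneg fun j _ => sq_nonneg _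
  have hx := Finset.sum_mul_sq_le_sq_mul_sq Finset.univ (fun j => U i j)
    (fun j => (T k j : ℝ) - r * U k j)
  have hy := Finset.sum_mul_sq_le_sq_mul_sq Finset.univ (fun j => (T i j : ℝ) - r * U i j)
    (fun j => (T k j : ℝ))
  have hdec : ∑ j, (T i j : ℝ) * T k j = r * (∑ j, U i j * ((T k j : ℝ) - r * U k j))
      + ∑ j, ((T i j : ℝ) - r * U i j) * T k j := by
    have : ∑ j, (T i j : ℝ) * T k j = r * (∑ j, U i j * ((T k j : ℝ) - r * U k j))
      + ∑ j, ((T i j : ℝ) - r * U i j) * T k j + r ^ 2 * ∑ j, U i j * U k j := by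
      simp only [Finset.mul_sum, ← Finset.sum_add_distrib]
      exact Finset.sum_congr rfl fun j _ => by ring
    rw [this, hUo]; ring
  rw [hdec] at hg4
  simp only [hUd, hTsq] at hx hy
  simp only [Finset.sum_const, Finset.card_univ, Fintype.card_fin, nsmul_eq_mul, mul_one,
    one_mul] at hx hy
  change _ ≤ e k at hx
  change _ ≤ e i * N at hy
  set x := ∑ j, U i j * ((T k j : ℝ) - r * U k j)
  set y := ∑ j, ((T i j : ℝ) - r * U i j) * T k j
  have h2 : 2 ≤ N * (e i + e k) := by
    have h3 : (r * x + y) ^ 2 ≤ 2 * (r ^ 2 * x ^ 2 + y ^ 2) := by nlinarith [sq_nonneg (r * x - y)]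
    rw [hrr] at h3
    nlinarith [mul_le_mul_of_nonneg_left hx hn.le]
  have h4 : 2 ≤ N * (2 * N * N - 2 * r * ∑ a, ∑ j, |U a j|) := by
    rw [← hsum]
    exact h2.trans (mul_le_mul_of_nonneg_left hle hn.le)
  set Q := ∑ a, ∑ j, |U a j|
  have h5 : 1 / (N * r) ≤ N * r - Q := by
    rw [div_le_iff₀ (by positivity)]
    have : (N * r - Q) * (N * r) = N * (N * r ^ 2 - r * Q) := by ring
    rw [this, hrr]
    linarith
  linarith
end

section
/- Let H ∈ M_N(ℝ) be a real Hadamard matrix and λ ∈ ℝ. Then the following are equivalent: (1) H is bistochastic with sums λ, i.e. every row sum and every column sum of H equals λ; (2) every row sum of H equals λ and λ² = N. In particular, if there exists a real Hadamard matrix of size N all of whose row sums and column sums are equal to a common value, then N is a perfect square. -/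
theorem aux_sq {N : ℕ} (hN : 0 < N) (H : Matrix (Fin N) (Fin N) ℝ) (lam : ℝ)
    (hH : H * H.transpose = (N : ℝ) • (1 : Matrix (Fin N) (Fin N) ℝ))
    (hr : ∀ i, ∑ j, H i j = lam) (hc : ∀ j, ∑ i, H i j = lam) : lam ^ 2 = N := by
  have h1 : H.mulVec (fun _ => 1) = fun _ => lam := by
    ext i; simp [Matrix.mulVec, dotProduct, hr]
  have h2 : H.transpose.mulVec (fun _ => 1) = lam • (fun _ => (1 : ℝ)) := by
    ext i; simp [Matrix.mulVec, dotProduct, hc]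
  have h3 := congrArg (fun M => M.mulVec (fun _ => (1 : ℝ)) ⟨0, hN⟩) hH
  simp only [← Matrix.mulVec_mulVec] at h3
  rw [h2, Matrix.mulVec_smul, h1, Matrix.smul_mulVec, Matrix.one_mulVec] at h3
  simp at h3
  rw [← h3]; ring

theorem aux_col {N : ℕ} (hN : 0 < N) (H : Matrix (Fin N) (Fin N) ℝ) (lam : ℝ)
    (hH : H * H.transpose = (N : ℝ) • (1 : Matrix (Fin N) (Fin N) ℝ))
    (hr : ∀ i, ∑ j, H i j = lam) (hl : lam ^ 2 = N) : ∀ j, ∑ i, H i j = lam := by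
  have hN' : (N : ℝ) ≠ 0 := by positivity
  have hl0 : lam ≠ 0 := by rintro rfl; simp at hl; exact hN' hl.symm
  have hinv : H * ((N : ℝ)⁻¹ • H.transpose) = 1 := by
    rw [Matrix.mul_smul, hH, smul_smul, inv_mul_cancel₀ hN', one_smul]
  have hinv' := mul_eq_one_comm.mp hinv
  intro j
  have h1 : H.mulVec (fun _ => 1) = lam • (fun _ => (1 : ℝ)) := by
    ext i; simp [Matrix.mulVec, dotProduct, hr]
  have h3 := congrArg (fun M => M.mulVec (fun _ => (1 : ℝ)) j) hinv'
  simp only [← Matrix.mulVec_mulVec] at h3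
  rw [h1, Matrix.mulVec_smul, Matrix.smul_mulVec, Matrix.one_mulVec] at h3
  have h4 : H.transpose.mulVec (fun _ => (1 : ℝ)) j = ∑ i, H i j := by
    simp [Matrix.mulVec, dotProduct]
  simp only [Pi.smul_apply, smul_eq_mul, h4] at h3
  rw [← hl] at h3
  field_simp at h3
  exact h3

/-- For a real Hadamard matrix `H` of size `N` and `λ ∈ ℝ`, being bistochastic with sums `λ`
is equivalent to being row-stochastic with sums `λ` together with `λ² = N`. In particular,
if some real Hadamard matrix of size `N` is bistochastic, then `N` is a perfect square. -/
theorem stmt_5 (N : ℕ) (hN : 0 < N) :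
    (∀ (H : Matrix (Fin N) (Fin N) ℝ) (lam : ℝ),
      (∀ i j, H i j = 1 ∨ H i j = -1) →
      H * H.transpose = (N : ℝ) • (1 : Matrix (Fin N) (Fin N) ℝ) →
      (((∀ i, ∑ j, H i j = lam) ∧ (∀ j, ∑ i, H i j = lam)) ↔
        ((∀ i, ∑ j, H i j = lam) ∧ lam ^ 2 = N))) ∧
    ((∃ (H : Matrix (Fin N) (Fin N) ℝ) (lam : ℝ),
      (∀ i j, H i j = 1 ∨ H i j = -1) ∧
        H * H.transpose = (N : ℝ) • (1 : Matrix (Fin N) (Fin N) ℝ) ∧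
        (∀ i, ∑ j, H i j = lam) ∧ (∀ j, ∑ i, H i j = lam)) →
      ∃ n : ℕ, N = n ^ 2) := by
  refine ⟨fun H lam _ hH => ⟨fun h => ⟨h.1, aux_sq hN H lam hH h.1 h.2⟩,
    fun h => ⟨h.1, aux_col hN H lam hH h.1 h.2⟩⟩, ?_⟩
  rintro ⟨H, lam, hpm, hH, hr, hc⟩
  have hsq := aux_sq hN H lam hH hr hc
  have hz : ∀ i j, ∃ z : ℤ, H i j = z := fun i j => by
    rcases hpm i j with h | h
    · exact ⟨1, by simp [h]⟩
    · exact ⟨-1, by simp [h]⟩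
  choose z hz using hz
  have hlam : lam = ((∑ j, z ⟨0, hN⟩ j : ℤ) : ℝ) := by
    rw [← hr ⟨0, hN⟩]; push_cast; exact Finset.sum_congr rfl fun j _ => hz _ _
  refine ⟨(∑ j, z ⟨0, hN⟩ j).natAbs, ?_⟩
  rw [hlam] at hsq
  zify
  rw [sq_abs]
  exact_mod_cast hsq.symm
end

section
/- Let p be a prime, a ≥ 1, l = p^a, and ζ = e^{2πi/l}. For a function f : ℤ/l → ℕ, one has ∑_{k ∈ ℤ/l} f(k)·ζ^k = 0 if and only if f is constant on the cosets of the subgroup of ℤ/l of order p, i.e. if and only if f(k + p^{a−1}) = f(k) for every k ∈ ℤ/l. Equivalently, every vanishing sum of l-th roots of unity is a sum, with nonnegative integer multiplicities, of rotated full sums of p-th roots of unity. -/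
open Polynomial in
theorem aux_forward (m p : ℕ) (hm : 0 < m) (hp : 0 < p) (P Φ Q : ℤ[X])
    (hΦ : Φ * (X ^ m - 1) = X ^ (m * p) - 1) (hPQ : P = Φ * Q)
    (hP : ∀ n, m * p ≤ n → P.coeff n = 0) :
    (∀ n, n + m < m * p → P.coeff (n + m) = P.coeff n) ∧
    (∀ n, n < m → P.coeff (n + m * p - m) = P.coeff n) := by
  have hlm : m ≤ m * p := Nat.le_mul_of_pos_right m hp
  have key : P * X ^ m - P = Q * X ^ (m * p) - Q := by
    rw [hPQ]; linear_combination Q * hΦ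
  have hc : ∀ n, (if m ≤ n then P.coeff (n - m) else 0) - P.coeff n
      = (if m * p ≤ n then Q.coeff (n - m * p) else 0) - Q.coeff n := by
    intro n
    have := congrArg (fun R => R.coeff n) key
    simpa only [coeff_sub, coeff_mul_X_pow'] using this
  have hQ : ∀ n, m ≤ n → Q.coeff n = 0 := by
    -- strong descent from the top coefficient
    by_contra! h
    obtain ⟨n, hn, hne⟩ := h
    have hQ0 : Q ≠ 0 := by rintro rfl; simp at hne
    have hd : m ≤ Q.natDegree := hn.trans (le_natDegree_of_ne_zero hne)
    have h1 := hc (Q.natDegree + m * p)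
    rw [if_pos (by omega), if_pos (by omega), hP _ (by omega), hP _ (by omega),
      Nat.add_sub_cancel, coeff_eq_zero_of_natDegree_lt (n := Q.natDegree + m * p) (by omega)] at h1
    have : Q.coeff Q.natDegree ≠ 0 := by simpa using hQ0
    omega
  constructor
  · intro n hn
    have h1 := hc (n + m)
    rw [if_pos (by omega), if_neg (by omega), hQ _ (by omega), Nat.add_sub_cancel] at h1
    omega
  · intro n hn
    have h1 := hc (n + m * p)
    rw [if_pos (by omega), if_pos (by omega), hQ (n + m * p) (by omega), Nat.add_sub_cancel,
      hP (n + m * p) (by omega)] at h1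
    have h2 := hc n
    rw [if_neg (by omega), if_neg (by omega)] at h2
    omega

/-- Vanishing sums of `l`-th roots of unity for `l = p^a` a prime power: a sum
`∑_k f(k) ζ^k` (with natural multiplicities `f`) vanishes iff `f` is constant on the
cosets of the subgroup of order `p` of `ℤ/l`, i.e. `f(k + p^(a-1)) = f(k)` for all `k`;
equivalently, every vanishing sum of `l`-th roots of unity is a nonnegative-integer
combination of rotated full sums of `p`-th roots of unity. -/
theorem stmt_13 (p a : ℕ) (hp : p.Prime) (ha : 1 ≤ a) [NeZero (p ^ a)]
    (f : ZMod (p ^ a) → ℕ) :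
    (∑ k : ZMod (p ^ a),
        (f k : ℂ) * Complex.exp (2 * (Real.pi : ℂ) * Complex.I / ((p : ℂ) ^ a)) ^ k.val = 0) ↔
      ∀ k : ZMod (p ^ a), f (k + ((p ^ (a - 1) : ℕ) : ZMod (p ^ a))) = f k := by
  have hl0 : p ^ a ≠ 0 := NeZero.ne _
  have hζ : IsPrimitiveRoot
      (Complex.exp (2 * (Real.pi : ℂ) * Complex.I / ((p : ℂ) ^ a))) (p ^ a) := by
    have := Complex.isPrimitiveRoot_exp (p ^ a) hl0
    push_cast at this
    exact this
  generalize Complex.exp (2 * (Real.pi : ℂ) * Complex.I / ((p : ℂ) ^ a)) = ζ at hζ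
  have hl : p ^ a = p ^ (a - 1) * p := by
    rw [← pow_succ]; congr 1; omega
  have hm : 0 < p ^ (a - 1) := pow_pos hp.pos _
  have hml : p ^ (a - 1) < p ^ a := Nat.pow_lt_pow_right hp.one_lt (by omega)
  constructor
  · intro h k
    haveI := Fact.mk hp
    let P : Polynomial ℤ :=
      ∑ k : ZMod (p ^ a), Polynomial.C (f k : ℤ) * Polynomial.X ^ k.val
    have hPz : Polynomial.aeval ζ P = 0 := by
      simpa [P] using h
    have hdvd : Polynomial.cyclotomic (p ^ a) ℤ ∣ P := by
      rw [Polynomial.cyclotomic_eq_minpoly hζ (Nat.pos_of_ne_zero hl0)]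
      exact minpoly.isIntegrallyClosed_dvd (hζ.isIntegral (Nat.pos_of_ne_zero hl0)) hPz
    have hcoef : ∀ n, P.coeff n = if n < p ^ a then (f (n : ZMod (p ^ a)) : ℤ) else 0 := by
      intro n
      simp only [P, Polynomial.finset_sum_coeff, Polynomial.coeff_C_mul, Polynomial.coeff_X_pow]
      split_ifs with hn
      · rw [Finset.sum_eq_single (n : ZMod (p ^ a))]
        · simp [ZMod.val_natCast, Nat.mod_eq_of_lt hn]
        · intro b _ hb
          rw [if_neg, mul_zero]
          rintro rfl
          exact hb (by simp)
        · simp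
      · apply Finset.sum_eq_zero
        intro b _
        rw [if_neg, mul_zero]
        have := ZMod.val_lt b
        omega
    obtain ⟨Q, hQ⟩ := hdvd
    have hΦ : Polynomial.cyclotomic (p ^ a) ℤ * (Polynomial.X ^ p ^ (a - 1) - 1)
        = Polynomial.X ^ (p ^ (a - 1) * p) - 1 := by
      have := Polynomial.cyclotomic_prime_pow_mul_X_pow_sub_one ℤ p (a - 1)
      rw [Nat.sub_add_cancel ha] at this
      rw [← hl]; exact this
    obtain ⟨h1, h2⟩ := aux_forward (p ^ (a - 1)) p hm hp.pos P _ Q hΦ hQ (by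
      intro n hn
      rw [hcoef, if_neg (by omega)])
    rw [← hl] at h1 h2
    have hk := ZMod.val_lt k
    by_cases hc : k.val + p ^ (a - 1) < p ^ a
    · have := h1 _ hc
      rw [hcoef, hcoef, if_pos hc, if_pos hk] at this
      have := Nat.cast_injective this
      simpa using this
    · obtain ⟨n, hn⟩ := Nat.exists_eq_add_of_le (not_lt.mp hc)
      have := h2 n (by omega)
      rw [show n + p ^ a - p ^ (a - 1) = k.val by omega, hcoef, hcoef, if_pos hk,
        if_pos (by omega)] at this
      have := Nat.cast_injective this
      have e : k + ((p ^ (a - 1) : ℕ) : ZMod (p ^ a)) = (n : ZMod (p ^ a)) := by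
        have := congrArg (Nat.cast : ℕ → ZMod (p ^ a)) hn
        rw [Nat.cast_add, Nat.cast_add, ZMod.natCast_self, zero_add,
          ZMod.natCast_zmod_val] at this
        exact this
      rw [e, ← this, ZMod.natCast_zmod_val]
  · intro h
    have hne : ζ ^ p ^ (a - 1) ≠ 1 := hζ.pow_ne_one_of_pos_of_lt hm.ne' hml
    have hS : ∑ k : ZMod (p ^ a), (f k : ℂ) * ζ ^ k.val
        = ζ ^ p ^ (a - 1) * ∑ k : ZMod (p ^ a), (f k : ℂ) * ζ ^ k.val := by
      conv_lhs => rw [← Equiv.sum_comp (Equiv.addRight ((p ^ (a - 1) : ℕ) : ZMod (p ^ a)))]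
      rw [Finset.mul_sum]
      refine Finset.sum_congr rfl fun k _ => ?_
      rw [Equiv.coe_addRight, h, ZMod.val_add, ZMod.val_natCast, Nat.mod_eq_of_lt hml]
      have : ζ ^ ((k.val + p ^ (a - 1)) % p ^ a) = ζ ^ (k.val + p ^ (a - 1)) := by
        conv_rhs => rw [← pow_mod_orderOf, ← hζ.eq_orderOf]
      rw [this, pow_add]; ring
    have : (ζ ^ p ^ (a - 1) - 1) * ∑ k : ZMod (p ^ a), (f k : ℂ) * ζ ^ k.val = 0 := by
      linear_combination -hS
    exact (mul_eq_zero.mp this).resolve_left (sub_ne_zero.mpr hne)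
end

section
/- Let H ∈ M_N(ℝ) be a real Hadamard matrix. Then the real vector space {A ∈ M_N(ℝ) : ∑_k H_{ik} H_{jk} (A_{ik} − A_{jk}) = 0 for all i,j}, whose dimension is by definition the defect d(H), is isomorphic to the space of symmetric real N×N matrices; in particular d(H) = N(N+1)/2. -/
/-- The enveloping tangent space (defect space) of a real Hadamard matrix `H`: the real
vector space of matrices `A ∈ M_N(ℝ)` with `∑_k H_ik H_jk (A_ik - A_jk) = 0` for all `i, j`. -/
def defectSpace (N : ℕ) (H : Matrix (Fin N) (Fin N) ℝ) :
    Submodule ℝ (Matrix (Fin N) (Fin N) ℝ) where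
  carrier := {A | ∀ i j, ∑ k, H i k * H j k * (A i k - A j k) = 0}
  add_mem' := by
    intro A B hA hB
    intro i j
    have key : ∀ k, H i k * H j k * ((A + B) i k - (A + B) j k)
        = H i k * H j k * (A i k - A j k) + H i k * H j k * (B i k - B j k) := by
      intro k
      simp only [Matrix.add_apply]
      ring
    rw [Finset.sum_congr rfl fun k _ => key k, Finset.sum_add_distrib, hA i j, hB i j, add_zero]
  zero_mem' := by
    intro i j
    simp
  smul_mem' := by
    intro c A hA
    intro i j
    have key : ∀ k, H i k * H j k * ((c • A) i k - (c • A) j k)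
        = c * (H i k * H j k * (A i k - A j k)) := by
      intro k
      simp only [Matrix.smul_apply, smul_eq_mul]
      ring
    rw [Finset.sum_congr rfl fun k _ => key k, ← Finset.mul_sum, hA i j, mul_zero]

/-- The space of symmetric real `N × N` matrices. -/
def symmSpace (N : ℕ) : Submodule ℝ (Matrix (Fin N) (Fin N) ℝ) where
  carrier := {A | A.transpose = A}
  add_mem' := by
    intro A B hA hB
    simp only [Set.mem_setOf_eq, Matrix.transpose_add] at *
    rw [hA, hB]
  zero_mem' := by
    simp only [Set.mem_setOf_eq, Matrix.transpose_zero]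
  smul_mem' := by
    intro c A hA
    simp only [Set.mem_setOf_eq, Matrix.transpose_smul] at *
    rw [hA]

/-- Symmetric matrices are functions on unordered pairs of indices. -/
def symmSpaceEquiv (N : ℕ) : symmSpace N ≃ₗ[ℝ] (Sym2 (Fin N) → ℝ) where
  toFun A := Sym2.lift ⟨fun i j => A.1 i j, fun i j => congrFun (congrFun A.2 j) i⟩
  map_add' A B := by
    funext z
    induction z with
    | _ i j => simp
  map_smul' c A := by
    funext z
    induction z with
    | _ i j => simp
  invFun f := ⟨Matrix.of fun i j => f s(i, j), by
    ext i j
    simp [Sym2.eq_swap]⟩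
  left_inv A := by
    ext i j
    simp
  right_inv f := by
    funext z
    induction z with
    | _ i j => simp

theorem finrank_symmSpace (N : ℕ) :
    Module.finrank ℝ (symmSpace N) = N * (N + 1) / 2 := by
  rw [(symmSpaceEquiv N).finrank_eq, Module.finrank_fintype_fun_eq_card, Sym2.card,
    Fintype.card_fin, Nat.choose_two_right, Nat.add_sub_cancel, mul_comm]

/-- The map `A ↦ (A ∘ H) Hᵀ` on all matrices. -/
def hadMap (N : ℕ) (H : Matrix (Fin N) (Fin N) ℝ) :
    Matrix (Fin N) (Fin N) ℝ →ₗ[ℝ] Matrix (Fin N) (Fin N) ℝ where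
  toFun A := Matrix.hadamard A H * H.transpose
  map_add' A B := by rw [Matrix.add_hadamard, add_mul]
  map_smul' c A := by rw [Matrix.smul_hadamard, Matrix.smul_mul, RingHom.id_apply]

theorem hadMap_mem_iff (N : ℕ) (H A : Matrix (Fin N) (Fin N) ℝ) :
    hadMap N H A ∈ symmSpace N ↔ A ∈ defectSpace N H := by
  change (Matrix.hadamard A H * H.transpose).transpose = Matrix.hadamard A H * H.transpose ↔
    ∀ i j, ∑ k, H i k * H j k * (A i k - A j k) = 0
  have key : ∀ i j, ∑ k, H i k * H j k * (A i k - A j k) =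
      (Matrix.hadamard A H * H.transpose) i j - (Matrix.hadamard A H * H.transpose) j i := by
    intro i j
    simp only [Matrix.mul_apply, Matrix.hadamard_apply, Matrix.transpose_apply]
    rw [← Finset.sum_sub_distrib]
    exact Finset.sum_congr rfl fun k _ => by ring
  simp only [key, sub_eq_zero]
  constructor
  · intro h i j
    exact (congrFun (congrFun h i) j).symm
  · intro h
    ext i j
    exact h j i

theorem hadMap_bijective (N : ℕ) (H : Matrix (Fin N) (Fin N) ℝ)
    (hpm : ∀ i j, H i j = 1 ∨ H i j = -1)
    (horth : H * H.transpose = (N : ℝ) • (1 : Matrix (Fin N) (Fin N) ℝ)) :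
    Function.Bijective (hadMap N H) := by
  have hsurj : Function.Surjective (hadMap N H) := by
    intro B
    refine ⟨Matrix.hadamard ((N : ℝ)⁻¹ • (B * H)) H, ?_⟩
    change Matrix.hadamard (Matrix.hadamard ((N : ℝ)⁻¹ • (B * H)) H) H * H.transpose = B
    have h1 : Matrix.hadamard (Matrix.hadamard ((N : ℝ)⁻¹ • (B * H)) H) H
        = (N : ℝ)⁻¹ • (B * H) := by
      ext i j
      rw [Matrix.hadamard_apply, Matrix.hadamard_apply]
      rcases hpm i j with h | h <;> simp [h]
    rw [h1, Matrix.smul_mul, Matrix.mul_assoc, horth, Matrix.mul_smul, Matrix.mul_one]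
    ext i j
    have hN : (N : ℝ) ≠ 0 := by
      have := i.pos
      positivity
    rw [Matrix.smul_apply, Matrix.smul_apply, smul_eq_mul, smul_eq_mul, inv_mul_cancel_left₀ hN]
  exact ⟨LinearMap.injective_iff_surjective.2 hsurj, hsurj⟩

/-- For a real Hadamard matrix `H ∈ M_N(ℝ)`, the defect space is isomorphic to the space of
symmetric matrices; in particular the defect is `d(H) = N(N+1)/2`. -/
theorem stmt_17 (N : ℕ) (H : Matrix (Fin N) (Fin N) ℝ)
    (hpm : ∀ i j, H i j = 1 ∨ H i j = -1)
    (horth : H * H.transpose = (N : ℝ) • (1 : Matrix (Fin N) (Fin N) ℝ)) :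
    Nonempty (defectSpace N H ≃ₗ[ℝ] symmSpace N) ∧
      Module.finrank ℝ (defectSpace N H) = N * (N + 1) / 2 := by
  have e : defectSpace N H ≃ₗ[ℝ] symmSpace N :=
    (LinearEquiv.ofBijective (hadMap N H) (hadMap_bijective N H hpm horth)).ofSubmodules _ _ (by
      ext B
      obtain ⟨A, rfl⟩ := (hadMap_bijective N H hpm horth).2 B
      rw [hadMap_mem_iff]
      constructor
      · rintro ⟨A', hA', h⟩
        have : A' = A := (hadMap_bijective N H hpm horth).1 h
        exact this ▸ hA'
      · intro h
        exact ⟨A, h, rfl⟩)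
  exact ⟨⟨e⟩, by rw [e.finrank_eq, finrank_symmSpace]⟩
end

section
/- Let N ≥ 1 have prime factorization N = p₁^{a₁} ⋯ p_s^{a_s}, and let F_N = (w^{jk})_{j,k=0,…,N−1} with w = e^{2πi/N} be the Fourier matrix. Then the defect of F_N, i.e. the real dimension of the space {A ∈ M_N(ℝ) : ∑_k (F_N)_{ik} conj((F_N)_{jk}) (A_{ik} − A_{jk}) = 0 for all i,j}, equals N · ∏_{i=1}^{s} (1 + a_i − a_i/p_i). -/
/-- The `N × N` Fourier matrix `F_N = (w^{jk})` with `w = e^{2πi/N}`. -/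
noncomputable def fourierMat (N : ℕ) : Matrix (Fin N) (Fin N) ℂ :=
  fun j k => Complex.exp (2 * (Real.pi : ℂ) * Complex.I / N) ^ ((j : ℕ) * (k : ℕ))

/-- The defect space of the Fourier matrix `F_N`: the real vector space of matrices
`A ∈ M_N(ℝ)` with `∑_k (F_N)_ik conj((F_N)_jk) (A_ik - A_jk) = 0` for all `i, j`. -/
noncomputable def fourierDefectSpace (N : ℕ) :
    Submodule ℝ (Matrix (Fin N) (Fin N) ℝ) where
  carrier := {A | ∀ i j, ∑ k, fourierMat N i k * starRingEnd ℂ (fourierMat N j k) *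
      ((A i k : ℂ) - (A j k : ℂ)) = 0}
  add_mem' := by
    intro A B hA hB
    intro i j
    have key : ∀ k, fourierMat N i k * starRingEnd ℂ (fourierMat N j k) *
          (((A + B) i k : ℂ) - ((A + B) j k : ℂ))
        = fourierMat N i k * starRingEnd ℂ (fourierMat N j k) * ((A i k : ℂ) - (A j k : ℂ))
          + fourierMat N i k * starRingEnd ℂ (fourierMat N j k) *
              ((B i k : ℂ) - (B j k : ℂ)) := by
      intro k
      simp only [Matrix.add_apply, Complex.ofReal_add]
      ring
    rw [Finset.sum_congr rfl fun k _ => key k, Finset.sum_add_distrib, hA i j, hB i j, add_zero]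
  zero_mem' := by
    intro i j
    simp
  smul_mem' := by
    intro c A hA
    intro i j
    have key : ∀ k, fourierMat N i k * starRingEnd ℂ (fourierMat N j k) *
          (((c • A) i k : ℂ) - ((c • A) j k : ℂ))
        = (c : ℂ) * (fourierMat N i k * starRingEnd ℂ (fourierMat N j k) *
            ((A i k : ℂ) - (A j k : ℂ))) := by
      intro k
      simp only [Matrix.smul_apply, smul_eq_mul, Complex.ofReal_mul]
      ring
    rw [Finset.sum_congr rfl fun k _ => key k, ← Finset.mul_sum, hA i j, mul_zero]

open Finset in
theorem fd_sum_divisors (N : ℕ) (hN : N ≠ 0) :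
    ∑ d ∈ N.divisors, (d.totient : ℚ) / d = ∏ p ∈ N.primeFactors,
        (1 + (N.factorization p : ℚ) - (N.factorization p : ℚ) / (p : ℚ)) := by
  let f : ArithmeticFunction ℚ := ⟨fun d => (d.totient : ℚ) / d, by simp⟩
  have hfa : ∀ d, f d = (d.totient : ℚ) / d := fun d => rfl
  have hf : f.IsMultiplicative := by
    refine ⟨by simp [hfa], ?_⟩
    intro m n h
    rw [hfa, hfa, hfa, Nat.totient_mul h]
    push_cast
    rw [mul_div_mul_comm]
  have hz : (ArithmeticFunction.zeta : ArithmeticFunction ℚ).IsMultiplicative :=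
    ArithmeticFunction.isMultiplicative_zeta.natCast
  have h1 := (hf.mul hz).multiplicative_factorization _ hN
  rw [ArithmeticFunction.coe_mul_zeta_apply] at h1
  simp only [hfa] at h1
  rw [h1, Finsupp.prod, Nat.support_factorization]
  refine Finset.prod_congr rfl fun p hp => ?_
  have hp' := Nat.prime_of_mem_primeFactors hp
  rw [ArithmeticFunction.coe_mul_zeta_apply, Nat.sum_divisors_prime_pow hp',
    Finset.sum_range_succ']
  have hp0 : (p : ℚ) ≠ 0 := by exact_mod_cast hp'.ne_zero
  have : ∀ i ∈ Finset.range (N.factorization p), f (p ^ (i + 1)) = 1 - 1 / (p : ℚ) := by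
    intro i _
    rw [hfa, Nat.totient_prime_pow hp' (Nat.succ_pos _)]
    rw [Nat.cast_mul, Nat.cast_sub hp'.one_le]
    push_cast
    field_simp
    ring
  rw [Finset.sum_congr rfl this, Finset.sum_const, Finset.card_range, hfa]
  simp
  ring

theorem fd_sum_order (N : ℕ) [NeZero N] :
    ((∑ m : ZMod N, Nat.card (ZMod N ⧸ AddSubgroup.zmultiples m) : ℕ) : ℚ) =
      N * ∑ d ∈ N.divisors, (d.totient : ℚ) / d := by
  have h1 : ∀ m : ZMod N, (Nat.card (ZMod N ⧸ AddSubgroup.zmultiples m) : ℚ)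
      = N * (1 / (addOrderOf m : ℚ)) := by
    intro m
    have h := AddSubgroup.card_eq_card_quotient_mul_card_addSubgroup (AddSubgroup.zmultiples m)
    rw [Nat.card_zmultiples, Nat.card_zmod] at h
    have h0 : (addOrderOf m : ℚ) ≠ 0 := by exact_mod_cast (addOrderOf_pos m).ne'
    have h2 : (N : ℚ) = Nat.card (ZMod N ⧸ AddSubgroup.zmultiples m) * addOrderOf m := by
      exact_mod_cast h
    rw [h2]
    field_simp
  push_cast
  rw [Finset.sum_congr rfl fun m _ => h1 m, ← Finset.mul_sum]
  congr 1
  have hmap : ∀ m ∈ (Finset.univ : Finset (ZMod N)), addOrderOf m ∈ N.divisors := by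
    intro m _
    rw [Nat.mem_divisors]
    refine ⟨?_, NeZero.ne N⟩
    have := addOrderOf_dvd_card (x := m)
    rwa [ZMod.card] at this
  rw [← Finset.sum_fiberwise_of_maps_to hmap]
  refine Finset.sum_congr rfl fun d hd => ?_
  have hc := IsAddCyclic.card_addOrderOf_eq_totient (α := ZMod N) (d := d)
    (by rw [ZMod.card]; exact Nat.dvd_of_mem_divisors hd)
  rw [Finset.sum_congr rfl (g := fun _ => 1 / (d : ℚ))
    (by intro x hx; rw [(Finset.mem_filter.1 hx).2])]
  rw [Finset.sum_const, hc, nsmul_eq_mul]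
  ring

noncomputable def fdCas (N : ℕ) [NeZero N] (x : ZMod N) : ℝ :=
  (ZMod.stdAddChar x : ℂ).re + (ZMod.stdAddChar x : ℂ).im

theorem fd_cas_mul (N : ℕ) [NeZero N] (x y : ZMod N) :
    fdCas N x * fdCas N y =
      (ZMod.stdAddChar (x - y) : ℂ).re + (ZMod.stdAddChar (x + y) : ℂ).im := by
  rw [sub_eq_add_neg, AddChar.map_add_eq_mul, AddChar.map_add_eq_mul, AddChar.map_neg_eq_conj]
  simp only [fdCas, Complex.mul_re, Complex.mul_im, Complex.conj_re, Complex.conj_im]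
  ring

theorem fd_cas_orth (N : ℕ) [NeZero N] (m l : ZMod N) :
    ∑ k, fdCas N (m * k) * fdCas N (k * l) = if m = l then (N : ℝ) else 0 := by
  simp only [fd_cas_mul, Finset.sum_add_distrib]
  have h1 : ∀ k : ZMod N, m * k - k * l = k * (m - l) := fun k => by ring
  have h2 : ∀ k : ZMod N, m * k + k * l = k * (m + l) := fun k => by ring
  simp only [h1, h2, ← Complex.re_sum, ← Complex.im_sum]
  rw [AddChar.sum_mulShift _ (ZMod.isPrimitive_stdAddChar N),
    AddChar.sum_mulShift _ (ZMod.isPrimitive_stdAddChar N)]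
  simp only [sub_eq_zero, ZMod.card]
  split_ifs <;> simp

/-- Hartley transform along rows. -/
noncomputable def fdHart (N : ℕ) [NeZero N] :
    (ZMod N → ZMod N → ℝ) →ₗ[ℝ] (ZMod N → ZMod N → ℝ) where
  toFun A := fun i m => ∑ k, fdCas N (m * k) * A i k
  map_add' A B := by
    ext i m
    simp [mul_add, Finset.sum_add_distrib]
  map_smul' c A := by
    ext i m
    simp only [Pi.smul_apply, smul_eq_mul, RingHom.id_apply, Finset.mul_sum]
    exact Finset.sum_congr rfl fun k _ => by ring

theorem fd_hart_hart (N : ℕ) [NeZero N] (A : ZMod N → ZMod N → ℝ) :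
    fdHart N (fdHart N A) = (N : ℝ) • A := by
  ext i m
  change ∑ k, fdCas N (m * k) * ∑ l, fdCas N (k * l) * A i l = _
  simp only [Finset.mul_sum]
  rw [Finset.sum_comm]
  simp only [← mul_assoc, ← Finset.sum_mul, fd_cas_orth]
  simp

noncomputable def fdLift (N : ℕ) [NeZero N] :
    ((Σ m : ZMod N, ZMod N ⧸ AddSubgroup.zmultiples m) → ℝ) →ₗ[ℝ] (ZMod N → ZMod N → ℝ) where
  toFun f := fun i m => f ⟨m, (i : ZMod N ⧸ AddSubgroup.zmultiples m)⟩
  map_add' _ _ := rfl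
  map_smul' _ _ := rfl

def fdInv (N : ℕ) (B : ZMod N → ZMod N → ℝ) : Prop := ∀ i m, B (i + m) m = B i m

theorem fd_inv_iff (N : ℕ) [NeZero N] (B : ZMod N → ZMod N → ℝ) :
    fdInv N B ↔ ∃ f, fdLift N f = B := by
  constructor
  · intro h
    have hp : ∀ m, Function.Periodic (fun i => B i m) m := fun m i => h i m
    exact ⟨fun x => (hp x.1).lift x.2, rfl⟩
  · rintro ⟨f, rfl⟩ i m
    change f ⟨m, _⟩ = f ⟨m, _⟩
    congr 2
    rw [QuotientAddGroup.eq]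
    simp [AddSubgroup.mem_zmultiples]

theorem fd_fourier (n : ℕ) (i k : ZMod (n + 1)) :
    fourierMat (n + 1) i k = ZMod.stdAddChar (i * k) := by
  have h : (i * k : ZMod (n + 1)) = ((i.val * k.val : ℕ) : ZMod (n + 1)) := by
    push_cast
    rw [ZMod.natCast_zmod_val, ZMod.natCast_zmod_val]
  rw [h, ZMod.stdAddChar_apply, ZMod.toCircle_natCast]
  change Complex.exp _ ^ (i.val * k.val) = _
  rw [← Complex.exp_nat_mul]
  congr 1
  push_cast
  ring

theorem fd_mem_iff (n : ℕ) (A : ZMod (n + 1) → ZMod (n + 1) → ℝ) :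
    (show Matrix (Fin (n + 1)) (Fin (n + 1)) ℝ from A) ∈ fourierDefectSpace (n + 1) ↔
      fdInv (n + 1) (fdHart (n + 1) A) := by
  let D : ZMod (n + 1) → ZMod (n + 1) → ℂ := fun m i =>
    ∑ k, (ZMod.stdAddChar (m * k) : ℂ) * (A i k : ℂ)
  have hD : ∀ m i, fdHart (n + 1) A i m = (D m i).re + (D m i).im := by
    intro m i
    change ∑ k, fdCas (n + 1) (m * k) * A i k = _
    simp only [D, Complex.re_sum, Complex.im_sum, Complex.re_mul_ofReal, Complex.im_mul_ofReal,
      ← Finset.sum_add_distrib, fdCas, add_mul]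
  have hD' : ∀ m i, fdHart (n + 1) A i (-m) = (D m i).re - (D m i).im := by
    intro m i
    change ∑ k, fdCas (n + 1) (-m * k) * A i k = _
    simp only [D, Complex.re_sum, Complex.im_sum, Complex.re_mul_ofReal, Complex.im_mul_ofReal,
      ← Finset.sum_sub_distrib, fdCas, neg_mul, AddChar.map_neg_eq_conj, Complex.conj_re,
      Complex.conj_im]
    exact Finset.sum_congr rfl fun k _ => by ring
  have h1 : (show Matrix (Fin (n + 1)) (Fin (n + 1)) ℝ from A) ∈ fourierDefectSpace (n + 1) ↔
      ∀ i j : ZMod (n + 1), D (i - j) i = D (i - j) j := by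
    change (∀ i j : ZMod (n + 1), ∑ k : ZMod (n + 1), fourierMat (n + 1) i k *
      starRingEnd ℂ (fourierMat (n + 1) j k) * ((A i k : ℂ) - (A j k : ℂ)) = 0) ↔ _
    refine forall_congr' fun i => forall_congr' fun j => ?_
    rw [← sub_eq_zero (a := D (i - j) i)]
    simp only [D, ← Finset.sum_sub_distrib, ← mul_sub]
    have : ∀ k : ZMod (n + 1), fourierMat (n + 1) i k *
      starRingEnd ℂ (fourierMat (n + 1) j k) = ZMod.stdAddChar ((i - j) * k) := by
      intro k
      rw [fd_fourier, fd_fourier, ← AddChar.map_neg_eq_conj, ← AddChar.map_add_eq_mul]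
      congr 1
      ring
    simp only [this]
  rw [h1]
  constructor
  · intro h i m
    have := h (i + m) i
    rw [add_sub_cancel_left] at this
    rw [hD, hD, this]
  · intro h i j
    have e1 := h j (i - j)
    have e2 := h i (-(i - j))
    rw [show j + (i - j) = i by ring, hD, hD] at e1
    rw [show i + -(i - j) = j by ring, hD', hD'] at e2
    apply Complex.ext <;> linarith

theorem fd_finrank (n : ℕ) : Module.finrank ℝ (fourierDefectSpace (n + 1)) =
    ∑ m : ZMod (n + 1), Nat.card (ZMod (n + 1) ⧸ AddSubgroup.zmultiples m) := by
  classical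
  have hN : ((n + 1 : ℕ) : ℝ) ≠ 0 := by exact_mod_cast Nat.succ_ne_zero n
  let T := (fdHart (n + 1)).comp (fdLift (n + 1))
  have hinj : Function.Injective T := by
    intro f g h
    have h2 : fdHart (n + 1) (T f) = fdHart (n + 1) (T g) := by rw [h]
    change fdHart (n + 1) (fdHart (n + 1) _) = fdHart (n + 1) (fdHart (n + 1) _) at h2
    rw [fd_hart_hart, fd_hart_hart] at h2
    have h3 := smul_right_injective _ hN h2
    funext ⟨m, q⟩
    induction q using QuotientAddGroup.induction_on with
    | H i => exact congrFun (congrFun h3 i) m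
  have hr : LinearMap.range T = fourierDefectSpace (n + 1) := by
    apply le_antisymm
    · rintro _ ⟨f, rfl⟩
      refine (fd_mem_iff n _).2 ?_
      change fdInv _ (fdHart (n + 1) (fdHart (n + 1) _))
      rw [fd_hart_hart, ← map_smul]
      exact (fd_inv_iff _ _).2 ⟨_, rfl⟩
    · intro A hA
      obtain ⟨f, hf⟩ := (fd_inv_iff _ _).1 ((fd_mem_iff n A).1 hA)
      refine ⟨((n + 1 : ℕ) : ℝ)⁻¹ • f, ?_⟩
      rw [map_smul]
      change _ • fdHart (n + 1) (fdLift (n + 1) f) = _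
      rw [hf, fd_hart_hart, inv_smul_smul₀ hN]
  have h4 : Module.finrank ℝ (fourierDefectSpace (n + 1)) =
      Module.finrank ℝ (LinearMap.range T) := by
    rw [← hr]
    rfl
  haveI : ∀ m : ZMod (n + 1), Fintype (ZMod (n + 1) ⧸ AddSubgroup.zmultiples m) :=
    fun m => Fintype.ofFinite _
  rw [h4, LinearMap.finrank_range_of_inj hinj, Module.finrank_fintype_fun_eq_card,
    Fintype.card_sigma]
  exact Finset.sum_congr rfl fun m _ => Nat.card_eq_fintype_card.symm

/-- The defect of the Fourier matrix: if `N = p₁^{a₁} ⋯ p_s^{a_s}`, then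
`d(F_N) = N ∏_i (1 + a_i - a_i / p_i)`. -/
theorem stmt_18 (N : ℕ) (hN : 1 ≤ N) :
    (Module.finrank ℝ (fourierDefectSpace N) : ℚ) =
      (N : ℚ) * ∏ p ∈ N.primeFactors,
        (1 + (N.factorization p : ℚ) - (N.factorization p : ℚ) / (p : ℚ)) := by
  obtain ⟨n, rfl⟩ : ∃ n, N = n + 1 := ⟨N - 1, by omega⟩
  rw [fd_finrank, fd_sum_order, fd_sum_divisors _ (Nat.succ_ne_zero n)]
end

section
/- Let A be a unital C*-algebra and let H ∈ M_3(A) be a 3×3 Hadamard matrix over A, meaning: every entry H_{ij} is a unitary of A; the entries commute on each row and on each column (H_{ij}H_{ik} = H_{ik}H_{ij} and H_{ij}H_{kj} = H_{kj}H_{ij} for all i,j,k); and the rows and columns are pairwise orthogonal, i.e. ∑_j H_{ij}H_{kj}* = ∑_j H_{ij}*H_{kj} = 3δ_{ik}·1 and ∑_i H_{ij}H_{ik}* = ∑_i H_{ij}*H_{ik} = 3δ_{jk}·1 for all indices. Then H is classical: all nine entries of H pairwise commute, i.e. H_{ij}H_{kl} = H_{kl}H_{ij} for all i,j,k,l. 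-/
section helpers
variable {A : Type*} [Ring A] [StarRing A]

lemma sum_zero_aux (x y z : unitary A) (h : (x : A) + y + z = 0) :
    (1 : A) + ((y * x⁻¹ : unitary A) : A) + ((y * x⁻¹ : unitary A) : A) * ((y * x⁻¹ : unitary A) : A) = 0
    ∧ z * x⁻¹ = (y * x⁻¹) * (y * x⁻¹) := by
  set w := y * x⁻¹ with hw
  set t := z * x⁻¹ with ht
  have h1 : (1 : A) + w + t = 0 := by
    have hx : (x : A) * ((x⁻¹ : unitary A) : A) = 1 := by
      rw [← Submonoid.coe_mul, mul_inv_cancel, Submonoid.coe_one]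
    have := congrArg (· * ((x⁻¹ : unitary A) : A)) h
    simp only [add_mul, zero_mul, hx] at this
    simpa [hw, ht] using this
  have ht2 : (t : A) = -(1 + w) := by
    rw [eq_neg_iff_add_eq_zero, add_comm]; exact h1
  have hww : (w : A) * star (w : A) = 1 := Unitary.mul_star_self_of_mem w.2
  have htt : (t : A) * star (t : A) = 1 := Unitary.mul_star_self_of_mem t.2
  have hww' : star (w : A) * (w : A) = 1 := Unitary.star_mul_self_of_mem w.2
  rw [ht2] at htt
  simp only [star_neg, star_add, star_one, neg_mul_neg, mul_add, add_mul, one_mul, mul_one, hww] at htt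
  have h3 : (1 : A) + w + star (w : A) = 0 := by
    have h4 : ((1 : A) + w + star (w : A)) + 1 = 1 := by
      rw [← add_assoc] at htt; exact htt
    exact add_eq_right.mp h4
  have h5 : (1 : A) + w + w * w = 0 := by
    have := congrArg (· * (w : A)) h3
    simp only [add_mul, one_mul, zero_mul, hww'] at this
    rw [← this]; abel
  refine ⟨h5, Subtype.ext ?_⟩
  have h6 : (t : A) = w * w := by
    apply add_left_cancel (a := (1 : A) + w)
    rw [h1, h5]
  exact h6

lemma ratio_aux (h3 : ∀ x : A, (3 : A) * x = 0 → x = 0) (p p' q q' m m' : unitary A)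
    (h : (p : A) + q + m = 0) (h' : (p' : A) + q' + m' = 0)
    (hp : Commute p p') (hq : Commute q q') (hm : Commute m m')
    (hr : q' * p'⁻¹ = (q * p⁻¹)⁻¹) :
    ∃ v : unitary A, v * v * v = 1 ∧ q = v * p ∧ m = v * v * p ∧ q' = v * v * p' ∧ m' = v * p' ∧
      Commute v p ∧ Commute v p' := by
  obtain ⟨h1, h2⟩ := sum_zero_aux _ _ _ h
  obtain ⟨-, h4⟩ := sum_zero_aux _ _ _ h'
  set v := q * p⁻¹ with hv
  have hv3 : v * v * v = 1 := by
    apply Subtype.ext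
    have e : (v : A) * v * v - 1 = (v - 1) * (1 + v + v * v) := by noncomm_ring
    rw [h1, mul_zero, sub_eq_zero] at e
    simpa using e
  have hvi : v⁻¹ = v * v := by rw [inv_eq_iff_mul_eq_one, ← mul_assoc]; exact hv3
  have eq : q = v * p := by simp [hv]
  have em : m = v * v * p := by rw [← h2]; simp
  have eq' : q' = v * v * p' := by rw [← hvi, ← hr]; simp
  have em' : m' = v * p' := by
    rw [hr, hvi] at h4
    have : v * v * (v * v) = v := by rw [← mul_assoc, hv3, one_mul]
    rw [this] at h4
    rw [← h4]; simp
  refine ⟨v, hv3, eq, em, eq', em', ?_⟩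
  have k1 : p * (v * v) * p' = v * p' * v * p := by
    have := hq.eq
    rw [eq, eq'] at this
    have := congrArg (v⁻¹ * ·) this
    simpa [mul_assoc] using this
  have k2 : p' * (v * v) * p = v * p * v * p' := by
    have := hm.eq
    rw [em, em'] at this
    have := congrArg (v⁻¹ * ·) this
    simpa [mul_assoc] using this.symm
  have k3 : (p : A) * p' = p' * p := by simpa using congrArg Subtype.val hp.eq
  replace k1 : (p : A) * (v * v) * p' = v * p' * v * p := by simpa using congrArg Subtype.val k1
  replace k2 : (p' : A) * (v * v) * p = v * p * v * p' := by simpa using congrArg Subtype.val k2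
  have hvv : (v : A) * v = -1 - v := by
    rw [← sub_eq_zero, ← h1]; abel
  have hv3' : (v : A) * (v * v) = 1 := by
    rw [← mul_assoc]; simpa using congrArg Subtype.val hv3
  set X : A := p * v * p' with hX
  set Y : A := p' * v * p with hY
  have l1 : v * Y = - ((p : A) * p') - X := by
    have : v * Y = v * p' * v * p := by rw [hY]; noncomm_ring
    rw [this, ← k1, hvv, hX]; noncomm_ring
  have l2 : v * X = - ((p : A) * p') - Y := by
    have : v * X = v * p * v * p' := by rw [hX]; noncomm_ring
    rw [this, ← k2, hvv, hY, k3]; noncomm_ring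
  have l3 : (v : A) * (X - Y) = X - Y := by
    rw [mul_sub, l1, l2]; abel
  have l4 : (3 : A) * (X - Y) = 0 := by
    have : (1 + v + v * v : A) * (X - Y) = 3 * (X - Y) := by
      rw [add_mul, add_mul, mul_assoc, l3, l3]; noncomm_ring
    rw [← this, h1, zero_mul]
  have l5 : X = Y := sub_eq_zero.mp (h3 _ l4)
  have l6 : (v : A) * (p * p') = X := by
    have e : (p : A) * p' = v * v * X := by
      rw [hvv, sub_mul, l2, ← l5]; noncomm_ring
    rw [e, ← mul_assoc, hv3', one_mul]
  have c1 : v * (p * p') = p * v * p' := by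
    apply Subtype.ext; simpa using l6
  have c2 : v * (p' * p) = p' * v * p := by
    apply Subtype.ext
    rw [l5, k3] at l6
    simpa using l6
  constructor
  · rw [← mul_assoc] at c1; exact mul_right_cancel c1
  · rw [← mul_assoc] at c2; exact mul_right_cancel c2

lemma block_aux (h3 : ∀ x : A, (3 : A) * x = 0 → x = 0) (a b c d e f g h i : unitary A)
    (hab : Commute a b) (hac : Commute a c) (hbc : Commute b c)
    (hde : Commute d e) (hdf : Commute d f) (hef : Commute e f)
    (hgh : Commute g h) (hgi : Commute g i) (hhi : Commute h i)
    (s1 : ((a⁻¹ * b : unitary A) : A) + (d⁻¹ * e : unitary A) + (g⁻¹ * h : unitary A) = 0)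
    (s2 : ((a⁻¹ * c : unitary A) : A) + (d⁻¹ * f : unitary A) + (g⁻¹ * i : unitary A) = 0)
    (r : ((a * d⁻¹ : unitary A) : A) + (b * e⁻¹ : unitary A) + (c * f⁻¹ : unitary A) = 0) :
    ∃ v : unitary A, v * v * v = 1 ∧ d⁻¹ * e = v * (a⁻¹ * b) ∧ g⁻¹ * h = v * v * (a⁻¹ * b) ∧
      d⁻¹ * f = v * v * (a⁻¹ * c) ∧ g⁻¹ * i = v * (a⁻¹ * c) ∧
      Commute v (a⁻¹ * b) ∧ Commute v (a⁻¹ * c) := by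
  have key : ∀ {x y z : unitary A}, Commute x y → Commute x z → Commute y z →
      Commute (x⁻¹ * y) (x⁻¹ * z) := by
    intro x y z hxy hxz hyz
    exact ((Commute.refl x).inv_inv.mul_right hxz.inv_left).mul_left
      (hxy.symm.inv_right.mul_right hyz)
  apply ratio_aux h3 _ _ _ _ _ _ s1 s2 (key hab hac hbc) (key hde hdf hef) (key hgh hgi hhi)
  obtain ⟨k1, k2⟩ := sum_zero_aux _ _ _ r
  set w := b * e⁻¹ * (a * d⁻¹)⁻¹ with hw
  have hw3 : w * w * w = 1 := by
    apply Subtype.ext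
    have e : (w : A) * w * w - 1 = (w - 1) * (1 + w + w * w) := by noncomm_ring
    rw [k1, mul_zero, sub_eq_zero] at e
    simpa using e
  have hwi : w * w = w⁻¹ := by rw [eq_comm, inv_eq_iff_mul_eq_one, ← mul_assoc]; exact hw3
  rw [hwi] at k2
  have k3 := congrArg (fun x => (a⁻¹ * x * a)⁻¹) k2
  simp only [hw] at k3
  simp only [mul_inv_rev, inv_inv, mul_assoc, inv_mul_cancel, mul_one] at k3 ⊢
  exact k3

end helpers

lemma group_aux {G : Type*} [Group G] (a b c d e f g h i v V : G)
    (hab : Commute a b) (hac : Commute a c) (had : Commute a d) (hag : Commute a g)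
    (hbe : Commute b e) (hde : Commute d e)
    (hbc : Commute (a⁻¹ * b) (a⁻¹ * c)) (hdg : Commute (a⁻¹ * d) (a⁻¹ * g))
    (v3 : v * v * v = 1) (v1 : d⁻¹ * e = v * (a⁻¹ * b)) (v2 : g⁻¹ * h = v * v * (a⁻¹ * b))
    (v4 : d⁻¹ * f = v * v * (a⁻¹ * c)) (v5 : g⁻¹ * i = v * (a⁻¹ * c))
    (v6 : Commute v (a⁻¹ * b)) (v7 : Commute v (a⁻¹ * c))
    (V3 : V * V * V = 1) (V1 : b⁻¹ * e = V * (a⁻¹ * d)) (V2 : c⁻¹ * f = V * V * (a⁻¹ * d))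
    (V4 : b⁻¹ * h = V * V * (a⁻¹ * g)) (V5 : c⁻¹ * i = V * (a⁻¹ * g))
    (V6 : Commute V (a⁻¹ * d)) (V7 : Commute V (a⁻¹ * g)) :
    ∃ s : Set G, (∀ x ∈ s, ∀ y ∈ s, Commute x y) ∧ a ∈ Subgroup.closure s ∧
      b ∈ Subgroup.closure s ∧ c ∈ Subgroup.closure s ∧ d ∈ Subgroup.closure s ∧
      e ∈ Subgroup.closure s ∧ f ∈ Subgroup.closure s ∧ g ∈ Subgroup.closure s ∧
      h ∈ Subgroup.closure s ∧ i ∈ Subgroup.closure s := by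
  obtain ⟨p, rfl⟩ : ∃ p, b = a * p := ⟨a⁻¹ * b, by simp⟩
  obtain ⟨p', rfl⟩ : ∃ p, c = a * p := ⟨a⁻¹ * c, by simp⟩
  obtain ⟨P, rfl⟩ : ∃ p, d = a * p := ⟨a⁻¹ * d, by simp⟩
  obtain ⟨P', rfl⟩ : ∃ p, g = a * p := ⟨a⁻¹ * g, by simp⟩
  simp only [inv_mul_cancel_left] at *
  have cp : Commute a p := by simpa [mul_assoc] using (Commute.refl a).inv_right.mul_right hab
  have cp' : Commute a p' := by simpa [mul_assoc] using (Commute.refl a).inv_right.mul_right hac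
  have cP : Commute a P := by simpa [mul_assoc] using (Commute.refl a).inv_right.mul_right had
  have cP' : Commute a P' := by simpa [mul_assoc] using (Commute.refl a).inv_right.mul_right hag
  rw [inv_mul_eq_iff_eq_mul] at v1 v2 v4 v5 V1 V2 V4 V5
  subst v1 v2 v4 v5
  simp only [mul_assoc, mul_right_inj] at V1 V2 V4 V5
  have av : a * v = V * a := by
    have h1 : a * P * (v * p) = (a * p) * (V * P) := by simp only [mul_assoc, V1]
    have h2 : (a * p) * (V * P) * (a * p) = (a * p) * (a * P * (v * p)) := by
      rw [← h1]; exact hbe.eq.symm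
    have h3 : V * P * (a * p) = a * P * (v * p) := by
      rw [mul_assoc (a * p)] at h2; exact mul_left_cancel h2
    have h4 : V * P * a = a * P * v := by
      simp only [← mul_assoc] at h3; exact mul_right_cancel h3
    rw [V6.eq, cP.eq, mul_assoc, mul_assoc] at h4
    exact (mul_left_cancel h4).symm
  have aV : a * V = v * a := by
    have h1 : a * P * (v * p) = (a * p) * (V * P) := by simp only [mul_assoc, V1]
    have h2 : (a * P) * ((v * p) * (a * P)) = (a * P) * ((a * p) * (V * P)) := by
      rw [← h1, ← mul_assoc]; exact hde.eq.symm
    have h3 : v * p * (a * P) = a * p * (V * P) := mul_left_cancel h2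
    have h4 : v * p * a = a * p * V := by
      simp only [← mul_assoc] at h3; exact mul_right_cancel h3
    rw [v6.eq, cp.eq, mul_assoc, mul_assoc] at h4
    exact (mul_left_cancel h4).symm
  have ev : v = a⁻¹ * V * a := by rw [mul_assoc, ← av]; simp
  have eV : V = a⁻¹ * v * a := by rw [mul_assoc, ← aV]; simp
  have vP : Commute v P := by
    rw [ev]; exact (cP.inv_left.mul_left V6).mul_left cP
  have Vp : Commute V p := by
    rw [eV]; exact (cp.inv_left.mul_left v6).mul_left cp
  have h1 : P * p * v = p * P * V := by
    rw [mul_assoc, ← v6.eq, V1, V6.eq, mul_assoc]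
  have hz : V * v⁻¹ = (p * P)⁻¹ * (P * p) := by
    rw [eq_inv_mul_iff_mul_eq, ← mul_assoc, ← h1]; simp
  have az : Commute a (V * v⁻¹) := by
    rw [hz]; exact (cp.mul_right cP).inv_right.mul_right (cP.mul_right cp)
  have vz : Commute v (V * v⁻¹) := by
    rw [hz]; exact (v6.mul_right vP).inv_right.mul_right (vP.mul_right v6)
  have vV : Commute v V := by
    have := vz.mul_right (Commute.refl v)
    simpa using this
  have h2 : v * V⁻¹ = V * v⁻¹ := by
    have e1 : a * (V * v⁻¹) = v * V⁻¹ * a := by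
      rw [← mul_assoc, aV, mul_assoc, mul_assoc]
      congr 1
      rw [mul_inv_eq_iff_eq_mul, mul_assoc, av]; simp
    rw [az.eq] at e1
    exact (mul_right_cancel e1).symm
  have h3 : v * v = V * V := by
    calc v * v = v * V⁻¹ * (V * v) := by simp [mul_assoc]
      _ = V * v⁻¹ * (V * v) := by rw [h2]
      _ = V * v⁻¹ * (v * V) := by rw [vV.eq]
      _ = V * V := by simp [mul_assoc]
  have hV : V = v := by
    have : V * V * v = V * V * V := by rw [V3, ← h3, v3]
    exact (mul_left_cancel this).symm
  subst hV
  have pP : Commute P p := mul_right_cancel h1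
  have vv := (Commute.refl V).mul_left (Commute.refl V)
  have cancelComm : ∀ {x y w : G}, Commute w x → Commute w y → x * (w * y) = y * (w * x) → Commute x y := by
    intro x y w hx hy hh
    rw [← mul_assoc, ← mul_assoc, ← hx.eq, ← hy.eq, mul_assoc, mul_assoc] at hh
    exact mul_left_cancel hh
  have pP' : Commute P p' := cancelComm (w := V * V) (V6.mul_left V6) (v7.mul_left v7) (by simpa [mul_assoc] using V2)
  have P'p : Commute P' p := cancelComm (w := V * V) (V7.mul_left V7) (v6.mul_left v6) (by simpa [mul_assoc] using V4)
  have P'p' : Commute P' p' := cancelComm V7 v7 V5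
  have aV' : Commute a V := av
  refine ⟨{a, p, p', P, P', V}, ?_, ?_⟩
  · intro x hx y hy
    simp only [Set.mem_insert_iff, Set.mem_singleton_iff] at hx hy
    rcases hx with rfl | rfl | rfl | rfl | rfl | rfl <;>
    rcases hy with rfl | rfl | rfl | rfl | rfl | rfl <;>
    first | exact Commute.refl _ | assumption | (apply Commute.symm; assumption)
  · set S := Subgroup.closure ({a, p, p', P, P', V} : Set G) with hS
    have m1 : a ∈ S := Subgroup.subset_closure (by simp)
    have m2 : p ∈ S := Subgroup.subset_closure (by simp)
    have m3 : p' ∈ S := Subgroup.subset_closure (by simp)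
    have m4 : P ∈ S := Subgroup.subset_closure (by simp)
    have m5 : P' ∈ S := Subgroup.subset_closure (by simp)
    have m6 : V ∈ S := Subgroup.subset_closure (by simp)
    refine ⟨?_, ?_, ?_, ?_, ?_, ?_, ?_, ?_, ?_⟩ <;>
    repeat' first | assumption | apply S.mul_mem


/-- A `3 × 3` Hadamard matrix over a unital C*-algebra (unitary entries, commutation on rows
and columns, orthogonal rows and columns) is automatically classical: all of its entries
pairwise commute. -/
theorem stmt_19 (A : Type*) [NormedRing A] [StarRing A] [CStarRing A] [CompleteSpace A]
    [NormedAlgebra ℂ A] [StarModule ℂ A]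
    (H : Matrix (Fin 3) (Fin 3) A)
    (hunit : ∀ i j, H i j ∈ unitary A)
    (hrowc : ∀ i j k, Commute (H i j) (H i k))
    (hcolc : ∀ i j k, Commute (H i j) (H k j))
    (hrow₁ : ∀ i k, ∑ j, H i j * star (H k j) = if i = k then (3 : A) else 0)
    (hrow₂ : ∀ i k, ∑ j, star (H i j) * H k j = if i = k then (3 : A) else 0)
    (hcol₁ : ∀ j k, ∑ i, H i j * star (H i k) = if j = k then (3 : A) else 0)
    (hcol₂ : ∀ j k, ∑ i, star (H i j) * H i k = if j = k then (3 : A) else 0) :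
    ∀ i j k l, Commute (H i j) (H k l) := by
  classical
  have h3 : ∀ x : A, (3 : A) * x = 0 → x = 0 := by
    intro x hx
    have h : (3 : ℂ) • x = 0 := by
      rw [← hx, Algebra.smul_def, map_ofNat]
    exact (smul_eq_zero.mp h).resolve_left (by norm_num)
  let U : Fin 3 → Fin 3 → unitary A := fun i j => ⟨H i j, hunit i j⟩
  have hrc : ∀ i j k, Commute (U i j) (U i k) := fun i j k => Subtype.ext (hrowc i j k)
  have hcc : ∀ i j k, Commute (U i j) (U k j) := fun i j k => Subtype.ext (hcolc i j k)
  have r1 : ∀ i k, i ≠ k → ((U i 0 * (U k 0)⁻¹ : unitary A) : A) + (U i 1 * (U k 1)⁻¹ : unitary A)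
      + (U i 2 * (U k 2)⁻¹ : unitary A) = 0 := by
    intro i k hik
    have := hrow₁ i k
    rw [if_neg hik, Fin.sum_univ_three] at this
    exact this
  have r2 : ∀ i k, i ≠ k → (((U i 0)⁻¹ * U k 0 : unitary A) : A) + ((U i 1)⁻¹ * U k 1 : unitary A)
      + ((U i 2)⁻¹ * U k 2 : unitary A) = 0 := by
    intro i k hik
    have := hrow₂ i k
    rw [if_neg hik, Fin.sum_univ_three] at this
    exact this
  have c1 : ∀ i k, i ≠ k → ((U 0 i * (U 0 k)⁻¹ : unitary A) : A) + (U 1 i * (U 1 k)⁻¹ : unitary A)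
      + (U 2 i * (U 2 k)⁻¹ : unitary A) = 0 := by
    intro i k hik
    have := hcol₁ i k
    rw [if_neg hik, Fin.sum_univ_three] at this
    exact this
  have c2 : ∀ i k, i ≠ k → (((U 0 i)⁻¹ * U 0 k : unitary A) : A) + ((U 1 i)⁻¹ * U 1 k : unitary A)
      + ((U 2 i)⁻¹ * U 2 k : unitary A) = 0 := by
    intro i k hik
    have := hcol₂ i k
    rw [if_neg hik, Fin.sum_univ_three] at this
    exact this
  have key : ∀ {x y z : unitary A}, Commute x y → Commute x z → Commute y z →
      Commute (x⁻¹ * y) (x⁻¹ * z) := by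
    intro x y z hxy hxz hyz
    exact ((Commute.refl x).inv_inv.mul_right hxz.inv_left).mul_left
      (hxy.symm.inv_right.mul_right hyz)
  obtain ⟨v, v3, v1, v2, v4, v5, v6, v7⟩ := block_aux h3 (U 0 0) (U 0 1) (U 0 2) (U 1 0) (U 1 1)
    (U 1 2) (U 2 0) (U 2 1) (U 2 2) (hrc _ _ _) (hrc _ _ _) (hrc _ _ _) (hrc _ _ _) (hrc _ _ _)
    (hrc _ _ _) (hrc _ _ _) (hrc _ _ _) (hrc _ _ _) (c2 0 1 (by decide)) (c2 0 2 (by decide))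
    (r1 0 1 (by decide))
  obtain ⟨V, V3, V1, V2, V4, V5, V6, V7⟩ := block_aux h3 (U 0 0) (U 1 0) (U 2 0) (U 0 1) (U 1 1)
    (U 2 1) (U 0 2) (U 1 2) (U 2 2) (hcc _ _ _) (hcc _ _ _) (hcc _ _ _) (hcc _ _ _) (hcc _ _ _)
    (hcc _ _ _) (hcc _ _ _) (hcc _ _ _) (hcc _ _ _) (r2 0 1 (by decide)) (r2 0 2 (by decide))
    (c1 0 1 (by decide))
  obtain ⟨s, hs, m⟩ := group_aux _ _ _ _ _ _ _ _ _ v V (hrc 0 0 1) (hrc 0 0 2) (hcc 0 0 1)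
    (hcc 0 0 2) (hcc 0 1 1) (hrc 1 0 1) (key (hrc _ _ _) (hrc _ _ _) (hrc _ _ _))
    (key (hcc _ _ _) (hcc _ _ _) (hcc _ _ _)) v3 v1 v2 v4 v5 v6 v7 V3 V1 V2 V4 V5 V6 V7
  have hm : ∀ i j, U i j ∈ Subgroup.closure s := by
    intro i j
    obtain ⟨n1, n2, n3, n4, n5, n6, n7, n8, n9⟩ := m
    fin_cases i <;> fin_cases j <;> assumption
  intro i j k l
  have hc : Commute (U i j) (U k l) := by
    refine Subgroup.closure_induction₂ (p := fun x y _ _ => Commute x y) ?_ ?_ ?_ ?_ ?_ ?_ ?_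
      (hm i j) (hm k l)
    · intro x y hx hy; exact hs x hx y hy
    · intro x _; exact Commute.one_left x
    · intro x _; exact Commute.one_right x
    · intro x y z _ _ _ h h'; exact h.mul_left h'
    · intro x y z _ _ _ h h'; exact h.mul_right h'
    · intro x y _ _ h; exact h.inv_left
    · intro x y _ _ h; exact h.inv_right
  exact congrArg Subtype.val hc.eq
end
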